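/- arXiv:1703.07881 — 5 statements merged into one kernel-verified Lean document; each statement's English description precedes it below -/
import Mathlib

section
/- Let A be a cancellative commutative monoid, X a finitely generated A-set, and k a nontrivial commutative ring. If the k-realization k[X] is a free module over the monoid algebra k[A], then X is a free A-set; that is, there is a subset B of X such that every element of X can be written uniquely in the form a • b with a ∈ A and b ∈ B. -/
/-- If left multiplication by `c` fixes a nonzero element of the monoid algebra of a cancellative
commutative monoid, then `c` permutes a finite set, and is therefore a unit. -/
lemma MonoidAlgebra.isUnit_of_single_mul_eq_self {k A : Type*} [Semiring k] [CancelCommMonoid A]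
    {c : A} {f : MonoidAlgebra k A} (hf : f ≠ 0) (h : MonoidAlgebra.single c 1 * f = f) :
    IsUnit c := by
  obtain ⟨a, ha⟩ : ∃ a, f.coeff a ≠ 0 := by
    by_contra! H
    exact hf (MonoidAlgebra.coeff_inj.mp (Finsupp.ext H))
  have hshift (b : A) : f.coeff (c * b) = f.coeff b := by
    conv_lhs => rw [← h]
    simp
  have hpow (n : ℕ) : f.coeff (c ^ n * a) = f.coeff a := by
    induction n with
    | zero => simp
    | succ n ih => rw [pow_succ', mul_assoc, hshift, ih]
  have hmem (n : ℕ) : c ^ n * a ∈ f.coeff.support := by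
    rw [Finsupp.mem_support_iff, hpow]
    exact ha
  obtain ⟨i, j, hij, heq⟩ := Finite.exists_ne_map_eq_of_infinite
    fun n : ℕ ↦ (⟨c ^ n * a, hmem n⟩ : f.coeff.support)
  have hc : c ^ i = c ^ j := mul_right_cancel (congrArg Subtype.val heq)
  wlog hlt : i < j generalizing i j
  · exact this j i hij.symm heq.symm hc.symm (by omega)
  refine IsUnit.of_pow_eq_one (n := j - i) (mul_left_cancel (a := c ^ i) ?_) (by omega)
  rw [← pow_add, mul_one, Nat.add_sub_cancel' hlt.le, hc]

lemma Module.Free.isUnit_of_single_smul_eq_self {k A M : Type*} [CommRing k] [CancelCommMonoid A]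
    [AddCommGroup M] [Module (MonoidAlgebra k A) M] [Module.Free (MonoidAlgebra k A) M]
    {c : A} {m : M} (hm : m ≠ 0) (h : MonoidAlgebra.single c (1 : k) • m = m) : IsUnit c := by
  let b := Module.Free.chooseBasis (MonoidAlgebra k A) M
  obtain ⟨i, hi⟩ : ∃ i, b.repr m i ≠ 0 := by
    by_contra! H
    exact hm (b.repr.map_eq_zero_iff.mp (Finsupp.ext H))
  refine MonoidAlgebra.isUnit_of_single_mul_eq_self hi ?_
  conv_rhs => rw [← h]
  simp

open Classical in
/-- The indicator of the units of a commutative monoid, as a monoid homomorphism. -/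
noncomputable def unitIndicator (k A : Type*) [CommRing k] [CommMonoid A] : A →* k where
  toFun a := if IsUnit a then 1 else 0
  map_one' := by simp
  map_mul' a b := by
    by_cases ha : IsUnit a <;> by_cases hb : IsUnit b <;> simp [IsUnit.mul_iff, ha, hb]

section Realization

variable {A X : Type*} [CancelCommMonoid A] [MulAction A X]

/-- A finitely generated `A`-set has a finite generating set in which no element is a multiple of
another one. -/
lemma exists_finset_generating_irredundant
    (hfg : ∃ S : Finset X, ∀ x : X, ∃ (a : A) (s : X), s ∈ S ∧ x = a • s) :
    ∃ S : Finset X, (∀ x : X, ∃ (a : A) (s : X), s ∈ S ∧ x = a • s) ∧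
      ∀ s ∈ S, ∀ t ∈ S, ∀ a : A, s = a • t → s = t := by
  classical
  obtain ⟨S, hS, hmin⟩ := exists_minimal_of_wellFoundedLT
    (fun S : Finset X ↦ ∀ x : X, ∃ (a : A) (s : X), s ∈ S ∧ x = a • s) hfg
  refine ⟨S, hS, fun s hs t ht a hst ↦ ?_⟩
  by_contra hne
  refine Finset.notMem_erase s S (hmin (y := S.erase s) (fun x ↦ ?_) (S.erase_subset s) hs)
  obtain ⟨b, r, hr, rfl⟩ := hS x
  by_cases hrs : r = s
  · exact ⟨b * a, t, Finset.mem_erase.mpr ⟨Ne.symm hne, ht⟩, by rw [hrs, mul_smul, ← hst]⟩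
  · exact ⟨b, r, Finset.mem_erase.mpr ⟨hrs, hr⟩, rfl⟩

variable (k : Type*) [CommRing k]

lemma single_smul_symm_single (a : A) (x : X) (c d : k) :
    MonoidAlgebra.single a c • (Representation.ofMulAction k A X).asModuleEquiv.symm
      (MonoidAlgebra.single x d) =
    (Representation.ofMulAction k A X).asModuleEquiv.symm
      (MonoidAlgebra.single (a • x) (c * d)) := by
  rw [LinearEquiv.eq_symm_apply, Representation.asModuleEquiv_map_smul]
  simp

lemma span_range_symm_single_eq_top {S : Finset X}
    (hS : ∀ x : X, ∃ (a : A) (s : X), s ∈ S ∧ x = a • s) :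
    Submodule.span (MonoidAlgebra k A) (Set.range fun s : S ↦
      (Representation.ofMulAction k A X).asModuleEquiv.symm (MonoidAlgebra.single s.1 1)) = ⊤ := by
  refine eq_top_iff.mpr fun m _ ↦ ?_
  obtain ⟨v, rfl⟩ := (Representation.ofMulAction k A X).asModuleEquiv.symm.surjective m
  induction v using MonoidAlgebra.induction_linear with
  | zero => simp
  | add v w hv hw => rw [map_add]; exact add_mem (hv trivial) (hw trivial)
  | single x c =>
    obtain ⟨a, s, hs, rfl⟩ := hS x
    rw [← mul_one c, ← single_smul_symm_single]
    exact Submodule.smul_mem _ _ (Submodule.subset_span ⟨⟨s, hs⟩, rfl⟩)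

open Classical in
/-- The linear map on the realization recording, for each `s ∈ S`, the total coefficient on the
orbit of `s` under the units of `A`. -/
noncomputable def unitOrbitSum (S : Finset X) :
    (Representation.ofMulAction k A X).asModule →ₗ[k] (S → k) :=
  Finsupp.linearCombination k
    (fun x (s : S) ↦ if ∃ u : A, IsUnit u ∧ x = u • s.1 then (1 : k) else 0) ∘ₗ
  (MonoidAlgebra.coeffLinearEquiv k).toLinearMap ∘ₗ
  (Representation.ofMulAction k A X).asModuleEquiv.toLinearMap

open Classical in
lemma unitOrbitSum_symm_single (S : Finset X) (x : X) (c : k) (s : S) :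
    unitOrbitSum (A := A) k S ((Representation.ofMulAction k A X).asModuleEquiv.symm
      (MonoidAlgebra.single x c)) s = if ∃ u : A, IsUnit u ∧ x = u • s.1 then c else 0 := by
  simp [unitOrbitSum]

lemma unitOrbitSum_smul {S : Finset X}
    (hS : ∀ s ∈ S, ∀ (a : A) (x : X), s = a • x → IsUnit a) (r : MonoidAlgebra k A)
    (m : (Representation.ofMulAction k A X).asModule) :
    unitOrbitSum k S (r • m) =
      MonoidAlgebra.lift k k A (unitIndicator k A) r • unitOrbitSum k S m := by
  classical
  obtain ⟨v, rfl⟩ := (Representation.ofMulAction k A X).asModuleEquiv.symm.surjective m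
  induction r using MonoidAlgebra.induction_linear with
  | zero => simp
  | add p q hp hq => rw [add_smul, map_add, map_add, add_smul, hp, hq]
  | single a c =>
  induction v using MonoidAlgebra.induction_linear with
  | zero => simp
  | add v w hv hw => rw [map_add, smul_add, map_add, map_add, smul_add, hv, hw]
  | single x d =>
  have key (s : S) : (∃ u : A, IsUnit u ∧ a • x = u • s.1) ↔
      IsUnit a ∧ ∃ u : A, IsUnit u ∧ x = u • s.1 := by
    constructor
    · rintro ⟨_, ⟨u, rfl⟩, h⟩
      have hs : s.1 = ((u⁻¹ : Aˣ) : A) • a • x := by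
        rw [h, smul_smul, Units.inv_mul, one_smul]
      have ha : IsUnit a := (IsUnit.mul_iff.mp (hS s.1 s.2 _ x (by rw [hs, smul_smul]))).2
      obtain ⟨w, rfl⟩ := ha
      refine ⟨w.isUnit, _, (w⁻¹ * u).isUnit, ?_⟩
      rw [Units.val_mul, mul_smul, ← h, smul_smul, Units.inv_mul, one_smul]
    · rintro ⟨ha, u, hu, rfl⟩
      exact ⟨a * u, ha.mul hu, by rw [mul_smul]⟩
  ext s
  rw [single_smul_symm_single, Pi.smul_apply, unitOrbitSum_symm_single, unitOrbitSum_symm_single]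
  by_cases ha : IsUnit a <;> simp [key, ha, unitIndicator]

lemma card_le_finrank_realization [Nontrivial k] {S : Finset X}
    [Module.Free (MonoidAlgebra k A) (Representation.ofMulAction k A X).asModule]
    (hgen : ∀ x : X, ∃ (a : A) (s : X), s ∈ S ∧ x = a • s)
    (hirr : ∀ s ∈ S, ∀ t ∈ S, ∀ a : A, s = a • t → s = t)
    (hS : ∀ s ∈ S, ∀ (a : A) (x : X), s = a • x → IsUnit a) :
    Fintype.card S ≤ Module.finrank (MonoidAlgebra k A)
      (Representation.ofMulAction k A X).asModule := by
  classical
  have : Module.Finite (MonoidAlgebra k A) (Representation.ofMulAction k A X).asModule :=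
    ⟨Submodule.fg_def.mpr ⟨_, Set.finite_range _, span_range_symm_single_eq_top k hgen⟩⟩
  let b := Module.Free.chooseBasis (MonoidAlgebra k A)
    (Representation.ofMulAction k A X).asModule
  rw [Module.finrank_eq_card_basis b]
  refine card_le_of_surjective k (Fintype.linearCombination k fun i ↦ unitOrbitSum k S (b i))
    (LinearMap.range_eq_top.mp (eq_top_iff.mpr ?_))
  rw [← (Pi.basisFun k S).span_eq, Submodule.span_le]
  rintro _ ⟨s, rfl⟩
  let m := (Representation.ofMulAction k A X).asModuleEquiv.symm (MonoidAlgebra.single s.1 1)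
  refine ⟨fun i ↦ MonoidAlgebra.lift k k A (unitIndicator k A) (b.repr m i), ?_⟩
  have hm : unitOrbitSum k S m = Pi.basisFun k S s := by
    ext t
    have : (∃ u : A, IsUnit u ∧ s.1 = u • t.1) ↔ s = t := by
      constructor
      · rintro ⟨u, -, h⟩
        exact Subtype.ext (hirr _ s.2 _ t.2 u h)
      · rintro rfl
        exact ⟨1, isUnit_one, by simp⟩
    rw [unitOrbitSum_symm_single, Pi.basisFun_apply, Pi.single_apply]
    simp [this, eq_comm]
  rw [← hm]
  conv_rhs => rw [← b.sum_repr m]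
  rw [map_sum, Fintype.linearCombination_apply]
  exact Finset.sum_congr rfl fun i _ ↦ (unitOrbitSum_smul k hS _ _).symm

end Realization


/-- **Theorem (free A-sets).** Let `A` be a cancellative commutative monoid, `X` a
finitely generated `A`-set and `k` a nontrivial commutative ring.  If the
`k`-realization `k[X] = X →₀ k`, viewed as a module over the monoid algebra
`k[A]` via the permutation representation induced by the action (i.e. via
`mapDomain` along the action, packaged as `(Representation.ofMulAction k A X).asModule`),
is a free `k[A]`-module, then `X` is a free `A`-set: there is a subset `B ⊆ X`
such that every element of `X` is uniquely of the form `a • b` with `a ∈ A`, `b ∈ B`. -/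
theorem free_realization_implies_free_aset
    (A : Type*) [CancelCommMonoid A] (X : Type*) [MulAction A X]
    (hfg : ∃ S : Finset X, ∀ x : X, ∃ (a : A) (s : X), s ∈ S ∧ x = a • s)
    (k : Type*) [CommRing k] [Nontrivial k]
    (hfree : Module.Free (MonoidAlgebra k A) (Representation.ofMulAction k A X).asModule) :
    ∃ B : Set X, ∀ x : X, ∃! p : A × X, p.2 ∈ B ∧ p.1 • p.2 = x := by
  classical
  obtain ⟨S, hgen, hirr⟩ := exists_finset_generating_irredundant hfg
  let e (x : X) := (Representation.ofMulAction k A X).asModuleEquiv.symm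
    (MonoidAlgebra.single x (1 : k))
  have hsmul (a : A) (x : X) : MonoidAlgebra.single a (1 : k) • e x = e (a • x) := by
    simp only [e, single_smul_symm_single, mul_one]
  have hS (s) (hs : s ∈ S) (a : A) (x : X) (h : s = a • x) : IsUnit a := by
    obtain ⟨b, t, ht, rfl⟩ := hgen x
    rw [smul_smul] at h
    obtain rfl := hirr s hs t ht _ h
    have he : e s ≠ 0 := by simp [e]
    exact (IsUnit.mul_iff.mp
      (Module.Free.isUnit_of_single_smul_eq_self (k := k) he (by rw [hsmul, ← h]))).1
  have hli : LinearIndependent (MonoidAlgebra k A) fun s : S ↦ e s.1 :=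
    linearIndependent_of_top_le_span_of_card_le_finrank
      (span_range_symm_single_eq_top k hgen).ge (card_le_finrank_realization k hgen hirr hS)
  refine ⟨S, fun x ↦ ?_⟩
  obtain ⟨a, s, hs, rfl⟩ := hgen x
  refine ⟨(a, s), ⟨hs, rfl⟩, ?_⟩
  rintro ⟨b, t⟩ ⟨ht, h⟩
  have hst : Finsupp.single (⟨t, ht⟩ : S) (MonoidAlgebra.single b (1 : k)) =
      Finsupp.single (⟨s, hs⟩ : S) (MonoidAlgebra.single a (1 : k)) := by
    apply hli
    simp only [Finsupp.linearCombination_single, hsmul]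
    exact congrArg e h
  rcases Finsupp.single_eq_single_iff _ _ _ _ |>.mp hst with ⟨h₁, h₂⟩ | ⟨h₁, -⟩
  · have hts : t = s := congrArg Subtype.val h₁
    have hba : b = a := MonoidAlgebra.single_left_injective one_ne_zero h₂
    rw [hts, hba]
  · simp at h₁
end

section
/- Let A be a commutative monoid and k a commutative ring. Let Ā denote the quotient monoid of A by its group of units (a ∼ b if and only if a = u*b for some unit u ∈ A^×), i.e. the monoid Associates A. Then the ring homomorphism k[A] → k[Ā] induced by the canonical projection A → Ā is surjective and its kernel is the ideal of k[A] generated by the set {u − 1 : u ∈ A^×}. Equivalently, k[Ā] ≅ k[A] ⊗_{k[A^×]} k, where k is a k[A^×]-algebra via the augmentation sending every unit to 1. -/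
/-- Moving every basis element within its fibre along units changes an element of the monoid
algebra only by a combination of the `u - 1`. -/
theorem MonoidAlgebra.sub_mapDomain_mem_span_units_sub_one
    {k A : Type*} [CommRing k] [CommMonoid A] {f : A → A} (hf : ∀ a, Associated (f a) a)
    (x : MonoidAlgebra k A) :
    x - MonoidAlgebra.mapDomain f x ∈
      Ideal.span {x : MonoidAlgebra k A | ∃ u : Aˣ, x = MonoidAlgebra.of k A ↑u - 1} := by
  induction x using MonoidAlgebra.induction_linear with
  | zero => simp
  | add x y hx hy =>
    rw [MonoidAlgebra.mapDomain_add, add_sub_add_comm]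
    exact add_mem hx hy
  | single a r =>
    obtain ⟨u, hu⟩ := hf a
    have h : MonoidAlgebra.single a r - MonoidAlgebra.mapDomain f (MonoidAlgebra.single a r) =
        MonoidAlgebra.single (f a) r * (MonoidAlgebra.of k A ↑u - 1) := by
      simp [mul_sub, MonoidAlgebra.single_mul_single, hu]
    rw [h]
    exact Ideal.mul_mem_left _ _ (Ideal.subset_span ⟨u, rfl⟩)

/-- **Lemma.** Let `A` be a commutative monoid, `k` a commutative ring, and let
`Ā = Associates A` be the quotient of `A` by its group of units.  The ring homomorphism
`k[A] → k[Ā]` induced by the canonical projection `A → Ā` is surjective, and its kernel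
is the ideal of `k[A]` generated by the elements `u - 1` for units `u ∈ Aˣ`. -/
theorem monoidAlgebra_associates_kernel
    (k : Type*) [CommRing k] (A : Type*) [CommMonoid A] :
    Function.Surjective
        (MonoidAlgebra.mapDomainRingHom k ((Associates.mkMonoidHom : A →* Associates A))) ∧
      RingHom.ker (MonoidAlgebra.mapDomainRingHom k ((Associates.mkMonoidHom : A →* Associates A))) =
        Ideal.span {x : MonoidAlgebra k A | ∃ u : Aˣ, x = MonoidAlgebra.of k A ↑u - 1} := by
  have hs (a : Associates A) : Associates.mk (Quotient.out a) = a := Quotient.out_eq a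
  constructor
  · intro y
    refine ⟨MonoidAlgebra.mapDomain Quotient.out y, ?_⟩
    induction y using MonoidAlgebra.induction_linear with
    | zero => simp
    | add x y hx hy => rw [MonoidAlgebra.mapDomain_add, map_add, hx, hy]
    | single a r => simp [hs]
  · apply le_antisymm
    · intro x hx
      have h := MonoidAlgebra.sub_mapDomain_mem_span_units_sub_one
        (f := fun a => Quotient.out (Associates.mk a))
        (fun a => Associates.mk_eq_mk_iff_associated.1 (Quotient.out_eq (Associates.mk a))) x
      have hx' : MonoidAlgebra.mapDomain Associates.mk x = 0 := hx
      have hc : MonoidAlgebra.mapDomain (fun a => Quotient.out (Associates.mk a)) x =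
          MonoidAlgebra.mapDomain Quotient.out (MonoidAlgebra.mapDomain Associates.mk x) := by
        ext; simp [← Finsupp.mapDomain_comp, Function.comp_def]
      rwa [hc, hx', MonoidAlgebra.mapDomain_zero, sub_zero] at h
    · rw [Ideal.span_le]
      rintro _ ⟨u, rfl⟩
      have hu : Associates.mk (u : A) = 1 := Associates.mk_eq_one.2 u.isUnit
      rw [SetLike.mem_coe, RingHom.mem_ker, map_sub, map_one, sub_eq_zero]
      simp [hu, MonoidAlgebra.one_def]
end

section
/- Let M be a cancellative commutative monoid whose only unit is 1. Let R be an M-graded ring and let T be a finitely generated, nonzero, M-graded R-module. Then R_{≠1}·T ≠ T, where R_{≠1} is the ideal of R given by the sum of the homogeneous components R_m with m ≠ 1. That is, the R-submodule of T generated by all products r • t with r homogeneous of degree m ≠ 1 is a proper submodule of T. -/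
open DirectSum in
/-- If `r` is homogeneous of degree `a` and `a` translates the support of `t` into `U`, then the
support of `r • t` is contained in `U`. -/
theorem decompose_smul_eq_zero_of_forall_mem
    {M R T : Type*} [Mul M] [DecidableEq M] [Ring R] [AddCommGroup T] [Module R T]
    {𝒜 : M → AddSubgroup R} {𝒯 : M → AddSubgroup T} [Decomposition 𝒯]
    (hsmul : ∀ (m n : M) (r : R) (t : T), r ∈ 𝒜 m → t ∈ 𝒯 n → r • t ∈ 𝒯 (m * n))
    {U : Set M} {a : M} {r : R} (hr : r ∈ 𝒜 a) {t : T}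
    (h : ∀ b, decompose 𝒯 t b ≠ 0 → a * b ∈ U) {n : M} (hn : n ∉ U) :
    decompose 𝒯 (r • t) n = 0 := by
  classical
  rw [← sum_support_decompose 𝒯 t, Finset.smul_sum, decompose_sum, DFinsupp.finsetSum_apply]
  refine Finset.sum_eq_zero fun b hb => Subtype.ext ?_
  refine decompose_of_mem_ne 𝒯 (hsmul a b r _ hr (decompose 𝒯 t b).2) ?_
  rintro rfl
  exact hn (h b (DFinsupp.mem_support_iff.mp hb))

open DirectSum in
/-- The elements of a graded module supported on `U` form a submodule, provided that `U` is stable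
under translation of degrees in which the module is nonzero. -/
theorem exists_submodule_mem_iff_decompose_eq_zero
    {M R T : Type*} [Mul M] [DecidableEq M] [Ring R] [AddCommGroup T] [Module R T]
    (𝒜 : M → AddSubgroup R) (𝒯 : M → AddSubgroup T) [Decomposition 𝒜] [Decomposition 𝒯]
    (hsmul : ∀ (m n : M) (r : R) (t : T), r ∈ 𝒜 m → t ∈ 𝒯 n → r • t ∈ 𝒯 (m * n))
    (U : Set M) (hU : ∀ a, ∀ b ∈ U, 𝒯 b ≠ ⊥ → a * b ∈ U) :
    ∃ N : Submodule R T, ∀ t, t ∈ N ↔ ∀ n ∉ U, decompose 𝒯 t n = 0 := by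
  refine ⟨{ carrier := {t | ∀ n ∉ U, decompose 𝒯 t n = 0}
            zero_mem' := fun n _ => by simp
            add_mem' := fun {x y} hx hy n hn => by
              rw [decompose_add, DirectSum.add_apply, hx n hn, hy n hn, add_zero]
            smul_mem' := fun r t ht n hn => ?_ }, fun t => Iff.rfl⟩
  induction r using Decomposition.inductionOn 𝒜 with
  | zero => simp
  | add r s hr hs => rw [add_smul, decompose_add, DirectSum.add_apply, hr, hs, add_zero]
  | homogeneous r =>
    refine decompose_smul_eq_zero_of_forall_mem hsmul r.2 (fun b hb => hU _ b ?_ ?_) hn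
    · by_contra hbU
      exact hb (ht b hbU)
    · intro hbot
      exact hb (Subtype.ext ((AddSubgroup.eq_bot_iff_forall _).mp hbot _ (decompose 𝒯 t b).2))

/-- In a cancellative commutative monoid without nontrivial units, every nonempty finite set has a
minimal element with respect to divisibility. -/
theorem exists_mem_forall_dvd_imp_eq {M : Type*} [CancelCommMonoid M]
    (hM : ∀ a b : M, a * b = 1 → a = 1) {S : Finset M} (hS : S.Nonempty) :
    ∃ m ∈ S, ∀ s ∈ S, s ∣ m → s = m := by
  let _ : Preorder M :=
    { le := fun a b => a ∣ b
      le_refl := dvd_refl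
      le_trans := fun _ _ _ => dvd_trans }
  obtain ⟨m, hm⟩ := S.exists_minimal hS
  refine ⟨m, hm.1, fun s hs hsm => ?_⟩
  obtain ⟨c, hc⟩ : m ∣ s := hm.2 hs hsm
  obtain ⟨d, hd⟩ := hsm
  have hcd : c * d = 1 := mul_left_cancel (a := m) (by rw [← mul_assoc, ← hc, ← hd, mul_one])
  rw [hc, hM c d hcd, mul_one]

open DirectSum in
/-- A nonzero finitely generated graded module has a degree that is minimal with respect to
divisibility among the degrees in which the module is nonzero. -/
theorem exists_minimal_degree {M : Type*} [CancelCommMonoid M] [DecidableEq M]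
    (hM : ∀ a b : M, a * b = 1 → a = 1)
    {R T : Type*} [Ring R] [AddCommGroup T] [Module R T] [Module.Finite R T] [Nontrivial T]
    (𝒜 : M → AddSubgroup R) (𝒯 : M → AddSubgroup T) [Decomposition 𝒜] [Decomposition 𝒯]
    (hsmul : ∀ (m n : M) (r : R) (t : T), r ∈ 𝒜 m → t ∈ 𝒯 n → r • t ∈ 𝒯 (m * n)) :
    ∃ m, 𝒯 m ≠ ⊥ ∧ ∀ n, 𝒯 n ≠ ⊥ → n ∣ m → n = m := by
  classical
  obtain ⟨G, hG⟩ := (Module.Finite.fg_top : (⊤ : Submodule R T).FG)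
  let S : Finset M := G.biUnion fun g => (decompose 𝒯 g).support
  have hS : ∀ s ∈ S, 𝒯 s ≠ ⊥ := by
    intro s hs hbot
    obtain ⟨g, -, hg⟩ := Finset.mem_biUnion.mp hs
    exact DFinsupp.mem_support_iff.mp hg
      (Subtype.ext ((AddSubgroup.eq_bot_iff_forall _).mp hbot _ (decompose 𝒯 g s).2))
  obtain ⟨N, hN⟩ := exists_submodule_mem_iff_decompose_eq_zero 𝒜 𝒯 hsmul
    {n | ∃ s ∈ S, s ∣ n} (fun a b ⟨s, hs, hsb⟩ _ => ⟨s, hs, hsb.mul_left a⟩)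
  have hNtop : N = ⊤ := by
    rw [eq_top_iff, ← hG, Submodule.span_le]
    intro g hg
    refine (hN g).mpr fun n hn => ?_
    by_contra hgn
    exact hn ⟨n, Finset.mem_biUnion.mpr ⟨g, hg, DFinsupp.mem_support_iff.mpr hgn⟩, dvd_rfl⟩
  have hdvd : ∀ n, 𝒯 n ≠ ⊥ → ∃ s ∈ S, s ∣ n := by
    intro n hn
    by_contra hnS
    refine hn ((AddSubgroup.eq_bot_iff_forall _).mpr fun t ht => ?_)
    have h0 := (hN t).mp (hNtop ▸ Submodule.mem_top) n hnS
    rw [← decompose_of_mem_same 𝒯 ht, h0, ZeroMemClass.coe_zero]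
  have hSne : S.Nonempty := by
    obtain ⟨t, ht⟩ := exists_ne (0 : T)
    by_contra hempty
    refine ht ((decompose 𝒯).injective (DFinsupp.ext fun n => ?_))
    rw [decompose_zero]
    refine (hN t).mp (hNtop ▸ Submodule.mem_top) n ?_
    rintro ⟨s, hs, -⟩
    exact hempty ⟨s, hs⟩
  obtain ⟨m, hm, hmin⟩ := exists_mem_forall_dvd_imp_eq hM hSne
  refine ⟨m, hS m hm, fun n hn hnm => ?_⟩
  obtain ⟨s, hs, hsn⟩ := hdvd n hn
  obtain rfl := hmin s hs (hsn.trans hnm)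
  obtain ⟨c, rfl⟩ := hsn
  obtain ⟨d, hd⟩ := hnm
  have hcd : c * d = 1 := mul_left_cancel (a := s) (by rw [← mul_assoc, ← hd, mul_one])
  rw [hM c d hcd, mul_one]

/-- **Lemma (graded Nakayama).** Let `M` be a cancellative commutative monoid whose only
unit is `1`, let `R` be an `M`-graded ring (direct sum decomposition `𝒜` with `1 ∈ 𝒜 1`
and `𝒜 m * 𝒜 n ⊆ 𝒜 (m*n)`) and let `T` be a finitely generated nonzero `M`-graded
`R`-module.  Then `R_{≠1} • T ≠ T`: the `R`-submodule of `T` generated by all products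
`r • t` with `r` homogeneous of degree `m ≠ 1` is a proper submodule of `T`. -/
theorem graded_nakayama
    (M : Type*) [CancelCommMonoid M] [DecidableEq M] (hM : ∀ a b : M, a * b = 1 → a = 1)
    (R : Type*) [Ring R] (𝒜 : M → AddSubgroup R)
    (hone : (1 : R) ∈ 𝒜 1)
    (hmul : ∀ (m n : M) (r s : R), r ∈ 𝒜 m → s ∈ 𝒜 n → r * s ∈ 𝒜 (m * n))
    (hAdec : DirectSum.IsInternal 𝒜)
    (T : Type*) [AddCommGroup T] [Module R T] [Module.Finite R T] [Nontrivial T]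
    (𝒯 : M → AddSubgroup T)
    (hsmul : ∀ (m n : M) (r : R) (t : T), r ∈ 𝒜 m → t ∈ 𝒯 n → r • t ∈ 𝒯 (m * n))
    (hTdec : DirectSum.IsInternal 𝒯) :
    Submodule.span R {x : T | ∃ m : M, m ≠ 1 ∧ ∃ r ∈ 𝒜 m, ∃ t : T, x = r • t} ≠ ⊤ := by
  classical
  let _ : DirectSum.Decomposition 𝒜 := hAdec.chooseDecomposition
  let _ : DirectSum.Decomposition 𝒯 := hTdec.chooseDecomposition
  obtain ⟨m, hm, hmin⟩ := exists_minimal_degree hM 𝒜 𝒯 hsmul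
  obtain ⟨N, hN⟩ := exists_submodule_mem_iff_decompose_eq_zero 𝒜 𝒯 hsmul {m}ᶜ
    (fun a b hb hbot hab => hb (hmin b hbot ⟨a, by rw [mul_comm]; exact hab.symm⟩))
  intro htop
  have hNtop : N = ⊤ := by
    rw [eq_top_iff, ← htop, Submodule.span_le]
    rintro _ ⟨a, ha, r, hr, t, rfl⟩
    refine (hN _).mpr fun n hn => decompose_smul_eq_zero_of_forall_mem hsmul hr ?_ hn
    intro b hb hab
    have hbot : 𝒯 b ≠ ⊥ := fun h =>
      hb (Subtype.ext ((AddSubgroup.eq_bot_iff_forall _).mp h _ (DirectSum.decompose 𝒯 t b).2))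
    obtain rfl := hmin b hbot ⟨a, by rw [mul_comm]; exact hab.symm⟩
    exact ha (mul_eq_right.mp hab)
  refine hm ((AddSubgroup.eq_bot_iff_forall _).mpr fun t ht => ?_)
  have h0 := (hN t).mp (hNtop ▸ Submodule.mem_top) m (fun h => h rfl)
  rw [← DirectSum.decompose_of_mem_same 𝒯 ht, h0, ZeroMemClass.coe_zero]
end

section
/- Let A be a cancellative commutative monoid whose only unit is 1, and let X be a finitely generated cancellative A-set, partially ordered by x ≤ y if and only if y = a • x for some a ∈ A. Then the set B of minimal elements of X is finite, B generates X (every x ∈ X equals a • b for some a ∈ A and b ∈ B), and B is contained in every generating subset of X; that is, B is the unique smallest generating set of X. -/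
/-- The orbit preorder of a monoid action: `x ≤ y` if and only if `y = a • x` for some `a`. -/
abbrev MulAction.orbitPreorder (A X : Type*) [Monoid A] [MulAction A X] : Preorder X where
  le x y := ∃ a : A, y = a • x
  le_refl x := ⟨1, (one_smul A x).symm⟩
  le_trans := by
    rintro x _ _ ⟨a, rfl⟩ ⟨b, rfl⟩
    exact ⟨b * a, (mul_smul b a x).symm⟩

/-- In a preorder, if every element lies above an element of a finite set, then every element
lies above a minimal element. -/
theorem exists_isMin_le_of_finite {X : Type*} [Preorder X] {S : Set X} (hS : S.Finite)
    (hgen : ∀ x, ∃ s ∈ S, s ≤ x) (x : X) : ∃ b, IsMin b ∧ b ≤ x := by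
  obtain ⟨s₀, hs₀, hs₀x⟩ := hgen x
  obtain ⟨b, hbx, hb⟩ := hS.exists_le_minimal hs₀
  refine ⟨b, fun y hyb => ?_, hbx.trans hs₀x⟩
  obtain ⟨s, hs, hsy⟩ := hgen y
  exact (hb.le_of_le hs (hsy.trans hyb)).trans hsy

/-- **Lemma.** Let `A` be a cancellative commutative monoid whose only unit is `1`, and
let `X` be a finitely generated cancellative `A`-set, partially ordered by
`x ≤ y ↔ ∃ a, y = a • x`.  Then the set `B` of minimal elements of `X` is finite, `B`
generates `X`, and `B` is contained in every generating subset of `X`; that is, `B` is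
the unique smallest generating set of `X`. -/
theorem minimal_elements_smallest_generating_set
    (A : Type*) [CancelCommMonoid A] (hA : ∀ a b : A, a * b = 1 → a = 1)
    (X : Type*) [MulAction A X]
    (hX : ∀ (a b : A) (x : X), a • x = b • x → a = b)
    (hfg : ∃ S : Finset X, ∀ x : X, ∃ (a : A) (s : X), s ∈ S ∧ x = a • s)
    (B : Set X)
    (hB : B = {b : X | ¬ ∃ y : X, (∃ a : A, b = a • y) ∧ ¬ (∃ a : A, y = a • b)}) :
    B.Finite ∧ (∀ x : X, ∃ (a : A) (b : X), b ∈ B ∧ x = a • b) ∧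
      ∀ S : Set X, (∀ x : X, ∃ (a : A) (s : X), s ∈ S ∧ x = a • s) → B ⊆ S := by
  let _ := MulAction.orbitPreorder A X
  have mem_B (b : X) : b ∈ B ↔ IsMin b := by
    rw [isMin_iff_forall_not_lt, hB, Set.mem_ofPred_eq, not_exists]
    simp only [lt_iff_le_not_ge]
    rfl
  have subset_of_gen (S : Set X) (hS : ∀ x : X, ∃ (a : A) (s : X), s ∈ S ∧ x = a • s) :
      B ⊆ S := by
    intro b hb
    obtain ⟨a, s, hs, hbs⟩ := hS b
    obtain ⟨c, hc⟩ := (mem_B b).1 hb ⟨a, hbs⟩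
    have hac : a * c = 1 := hX _ _ b (by rw [mul_smul, ← hc, ← hbs, one_smul])
    rwa [hbs, hA a c hac, one_smul]
  obtain ⟨S, hS⟩ := hfg
  refine ⟨S.finite_toSet.subset (subset_of_gen S hS), fun x => ?_, subset_of_gen⟩
  obtain ⟨b, hb, a, ha⟩ := exists_isMin_le_of_finite S.finite_toSet
    (fun y => let ⟨a, s, hs, h⟩ := hS y; ⟨s, hs, Exists.intro a h⟩) x
  exact ⟨a, b, (mem_B b).2 hb, ha⟩
end

section
/- Let R be a commutative local ring whose residue field is finite. For each integer l > 0 there exists a monic polynomial f ∈ R[x] of degree l such that R' = R[x]/(f) is a local ring and the image of the derivative f' in R' is a unit. In particular, R → R' is a finite étale extension of rank l (R' is a free R-module of rank l) with (R', mR') local, where m is the maximal ideal of R. -/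
open Polynomial in
/-- A finite field admits monic irreducible polynomials of every positive degree. -/
theorem FiniteField.exists_monic_irreducible_natDegree_eq
    (k : Type*) [Field k] [Finite k] (n : ℕ) (hn : 0 < n) :
    ∃ g : k[X], g.Monic ∧ Irreducible g ∧ g.natDegree = n := by
  obtain ⟨p, hp⟩ := CharP.exists k
  have : Fact p.Prime := ⟨CharP.char_is_prime k p⟩
  have : NeZero n := ⟨hn.ne'⟩
  obtain ⟨a, ha⟩ := Field.exists_primitive_element k (FiniteField.Extension k p n)
  have hint : IsIntegral k a := Algebra.IsIntegral.isIntegral a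
  refine ⟨minpoly k a, minpoly.monic hint, minpoly.irreducible hint, ?_⟩
  rw [(Field.primitive_element_iff_minpoly_natDegree_eq k a).mp ha]
  exact FiniteField.finrank_extension k p n

open Polynomial in
theorem AdjoinRoot.map_mk {R S : Type*} [CommRing R] [CommRing S] (φ : R →+* S)
    (f : R[X]) (g : S[X]) (h : g ∣ f.map φ) (p : R[X]) :
    AdjoinRoot.map φ f g h (AdjoinRoot.mk f p) = AdjoinRoot.mk g (p.map φ) := by
  rw [AdjoinRoot.map, lift_mk, ← eval₂_map, ← algebraMap_eq, ← aeval_def, aeval_eq]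

open Polynomial IsLocalRing in
/-- For monic `f` over a local ring `R`, reduction `R[x]/(f) → k[x]/(f̄)` modulo the maximal ideal
reflects units. -/
theorem AdjoinRoot.isLocalHom_map_residue {R : Type*} [CommRing R] [IsLocalRing R]
    {f : R[X]} (hf : f.Monic) :
    IsLocalHom (AdjoinRoot.map (residue R) f (f.map (residue R)) dvd_rfl) := by
  set φ := AdjoinRoot.map (residue R) f (f.map (residue R)) dvd_rfl
  have hφ (p : R[X]) : φ (mk f p) = mk _ (p.map (residue R)) :=
    AdjoinRoot.map_mk ..
  have ker_le : RingHom.ker φ ≤ (maximalIdeal R).map (AdjoinRoot.of f) := by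
    intro x hx
    obtain ⟨p, rfl⟩ := mk_surjective x
    rw [RingHom.mem_ker, hφ, mk_eq_zero] at hx
    obtain ⟨q, hq⟩ := hx
    obtain ⟨q, rfl⟩ := map_surjective _ residue_surjective q
    have hmem : p - f * q ∈ (maximalIdeal R).map (C : R →+* R[X]) := by
      rw [← ker_residue, ← ker_mapRingHom, RingHom.mem_ker]
      simp [hq]
    simpa [Ideal.map_map, AdjoinRoot.of] using Ideal.mem_map_of_mem (mk f) hmem
  have : Module.Finite R (AdjoinRoot f) := hf.finite_adjoinRoot
  refine ⟨fun x hx ↦ ?_⟩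
  by_contra hx'
  obtain ⟨M, hM, hxM⟩ := exists_max_ideal_of_mem_nonunits hx'
  have hle : RingHom.ker φ ≤ M := by
    refine ker_le.trans (Ideal.map_le_iff_le_comap.mpr ?_)
    exact (eq_maximalIdeal (Ideal.isMaximal_comap_of_isIntegral_of_isMaximal
      (R := R) (S := AdjoinRoot f) M)).ge
  obtain ⟨y, hy⟩ := hx.exists_right_inv
  obtain ⟨q, rfl⟩ := mk_surjective y
  obtain ⟨q, rfl⟩ := map_surjective _ residue_surjective q
  have h1 : x * mk f q - 1 ∈ M := hle (by rw [RingHom.mem_ker]; simp [hφ, hy])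
  refine hM.ne_top ((Ideal.eq_top_iff_one M).mpr ?_)
  simpa using M.sub_mem (M.mul_mem_right (mk f q) hxM) h1

/-- **Lemma.** Let `R` be a commutative local ring with finite residue field.  For each
integer `l > 0` there exists a monic polynomial `f ∈ R[x]` of degree `l` such that
`R' = R[x]/(f)` is local and the image of the derivative `f'` in `R'` is a unit.
In particular `R → R'` is a finite étale extension of rank `l`: `R'` is a free
`R`-module of rank `l`. -/
theorem exists_local_etale_extension
    (R : Type*) [CommRing R] [IsLocalRing R] [Finite (IsLocalRing.ResidueField R)]
    (l : ℕ) (hl : 0 < l) :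
    ∃ f : Polynomial R, f.Monic ∧ f.natDegree = l ∧
      IsLocalRing (AdjoinRoot f) ∧
      IsUnit (AdjoinRoot.mk f (Polynomial.derivative f)) ∧
      Module.Free R (AdjoinRoot f) ∧ Module.finrank R (AdjoinRoot f) = l := by
  let k := IsLocalRing.ResidueField R
  obtain ⟨g, hg, hirr, hdeg⟩ := FiniteField.exists_monic_irreducible_natDegree_eq k l hl
  obtain ⟨f, rfl, hfdeg, hf⟩ := Polynomial.lifts_and_natDegree_eq_and_monic
    ((Polynomial.lifts_iff_coeff_lifts g).mpr
      fun n ↦ IsLocalRing.residue_surjective (g.coeff n)) hg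
  have := AdjoinRoot.isLocalHom_map_residue hf
  have : Fact (Irreducible (f.map (IsLocalRing.residue R))) := ⟨hirr⟩
  refine ⟨f, hf, hfdeg.trans hdeg, RingHom.domain_isLocalRing
    (AdjoinRoot.map (IsLocalRing.residue R) f _ dvd_rfl), ?_, hf.free_adjoinRoot, ?_⟩
  · refine isUnit_of_map_unit (AdjoinRoot.map (IsLocalRing.residue R) f _ dvd_rfl) _ ?_
    obtain ⟨a, b, hab⟩ := PerfectField.separable_of_irreducible hirr
    refine IsUnit.of_mul_eq_one (AdjoinRoot.mk _ b) ?_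
    rw [AdjoinRoot.map_mk, ← Polynomial.derivative_map, ← map_one (AdjoinRoot.mk _), ← hab]
    simp [mul_comm]
  · rw [(AdjoinRoot.powerBasis' hf).finrank, AdjoinRoot.powerBasis'_dim, hfdeg, hdeg]
end
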